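/- Take the parameter m in the definition of H_n to depend on n as m = m(n) = ⌊log₂ log₂ n⌋. Then: (i) π(G_n)/π(H_n) → 0 as n → ∞; and (ii) it still holds that τ_{1/2}(G_n) ∉ O(τ_{1/2}(H_n)), i.e. for every constant c > 0 one has τ_{1/2}(G_n) > c·τ_{1/2}(H_n) for all sufficiently large n. Hence the conjecture of Hurlbert et al. fails even under the additional hypothesis that limsup π(G_n)/π(H_n) < 1 (indeed even when the limit is 0). -/

import Mathlib

open Finset

/-- A single pebbling move on `G`: remove two pebbles from a vertex `u` with at least
two pebbles and add one pebble to a vertex `v` adjacent to `u`. -/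
def PebblingMove {V : Type*} [DecidableEq V] (G : SimpleGraph V) (C C' : V → ℕ) : Prop :=
  ∃ u v : V, G.Adj u v ∧ 2 ≤ C u ∧
    C' = fun w => if w = u then C u - 2 else if w = v then C v + 1 else C w

/-- A configuration is solvable if every vertex can receive a pebble after finitely
many pebbling moves. -/
def Solvable {V : Type*} [DecidableEq V] (G : SimpleGraph V) (C : V → ℕ) : Prop :=
  ∀ v : V, ∃ C' : V → ℕ, Relation.ReflTransGen (PebblingMove G) C C' ∧ 1 ≤ C' v

/-- The pebbling number `π(G)`: the least `t` such that every configuration of size `t`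
is solvable. -/
noncomputable def pebblingNumber {V : Type*} [Fintype V] [DecidableEq V]
    (G : SimpleGraph V) : ℕ :=
  sInf {t : ℕ | ∀ C : V → ℕ, (∑ v, C v) = t → Solvable G C}

/-- The finset of all configurations of `t` pebbles on `n` vertices. -/
def configs (n t : ℕ) : Finset (Fin n → ℕ) :=
  (Fintype.piFinset fun _ : Fin n => Finset.range (t + 1)).filter fun C => ∑ i, C i = t

open scoped Classical in
/-- `P(G; t)`: the proportion of solvable configurations among all `C(n+t-1, t)`
configurations of size `t`. -/
noncomputable def solvableProportion (n : ℕ) (G : SimpleGraph (Fin n)) (t : ℕ) : ℝ :=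
  (((configs n t).filter fun C => Solvable G C).card : ℝ) / (Nat.choose (n + t - 1) t : ℝ)

/-- `τ_α(G)`: the least `t` with `P(G;t) ≥ α`. -/
noncomputable def tauAlpha (n : ℕ) (G : SimpleGraph (Fin n)) (α : ℝ) : ℕ :=
  sInf {t : ℕ | α ≤ solvableProportion n G t}

/-- A path on vertices `0, …, L-1` whose endpoint `L-1` is joined by an edge to vertex
`L` of the clique on vertices `L, …, n-1`. -/
def pathClique (n L : ℕ) : SimpleGraph (Fin n) :=
  SimpleGraph.fromRel fun i j =>
    (j.val = i.val + 1 ∧ j.val ≤ L) ∨ (L ≤ i.val ∧ L ≤ j.val)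

/-- `G_n`: a path with `⌊log₂ n⌋` vertices attached to a clique on the remaining vertices. -/
def Ggraph (n : ℕ) : SimpleGraph (Fin n) := pathClique n (Nat.log 2 n)

/-- Two disjoint paths on `0, …, L-1` and `L, …, 2L-1`, whose endpoints `L-1` and `2L-1`
are each joined by an edge to vertex `2L` of the clique on vertices `2L, …, n-1`. -/
def twoPathClique (n L : ℕ) : SimpleGraph (Fin n) :=
  SimpleGraph.fromRel fun i j =>
    (j.val = i.val + 1 ∧ j.val < L) ∨
    (L ≤ i.val ∧ j.val = i.val + 1 ∧ j.val < 2 * L) ∨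
    (2 * L ≤ i.val ∧ 2 * L ≤ j.val) ∨
    (i.val + 1 = L ∧ j.val = 2 * L) ∨
    (i.val + 1 = 2 * L ∧ j.val = 2 * L)

/-- `L' = ⌊(1/2)·log₂ n + m⌋`. -/
noncomputable def Lp (n m : ℕ) : ℕ := ⌊Real.logb 2 n / 2 + m⌋₊

/-- `H_n` with parameter `m`: two paths with `L'` vertices each, attached to a clique on
the remaining `n - 2L'` vertices. -/
noncomputable def Hgraph (n m : ℕ) : SimpleGraph (Fin n) := twoPathClique n (Lp n m)


section Dynamics

variable {V : Type*} [DecidableEq V] {G : SimpleGraph V}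

lemma exists_transfer {u v : V} (h : G.Adj u v) (k : ℕ) (C : V → ℕ) (hC : 2 * k ≤ C u) :
    ∃ C', Relation.ReflTransGen (PebblingMove G) C C' ∧ C' v = C v + k ∧
      ∀ w, w ≠ u → w ≠ v → C' w = C w := by
  suffices H : ∃ C', Relation.ReflTransGen (PebblingMove G) C C' ∧ C' v = C v + k ∧
      C' u = C u - 2 * k ∧ ∀ w, w ≠ u → w ≠ v → C' w = C w by
    obtain ⟨C', h1, h2, -, h3⟩ := H
    exact ⟨C', h1, h2, h3⟩
  induction k with
  | zero => exact ⟨C, .refl, by simp, by simp, fun _ _ _ => rfl⟩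
  | succ k ih =>
    obtain ⟨C', h1, h2, h3, h4⟩ := ih (by omega)
    refine ⟨_, h1.tail ⟨u, v, h, by omega, rfl⟩, ?_, ?_, ?_⟩
    · simp only [h.ne', if_false, if_true]; omega
    · simp only [if_true]; omega
    · intro w hu hv
      simp only [hu, hv, if_false]
      exact h4 w hu hv

lemma exists_reach_of_walk {u v : V} (p : G.Walk u v) (C : V → ℕ) (hC : 2 ^ p.length ≤ C u) :
    ∃ C', Relation.ReflTransGen (PebblingMove G) C C' ∧ 1 ≤ C' v := by
  induction p generalizing C with
  | nil => exact ⟨C, .refl, by simpa using hC⟩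
  | cons h p ih =>
    rw [SimpleGraph.Walk.length_cons, pow_succ'] at hC
    obtain ⟨C', h1, h2, -⟩ := exists_transfer h _ C hC
    obtain ⟨C'', h3, h4⟩ := ih C' (by omega)
    exact ⟨C'', h1.trans h3, h4⟩

lemma solvable_of_tower {u : V} {k : ℕ} (hw : ∀ v, ∃ p : G.Walk u v, p.length ≤ k) {C : V → ℕ}
    (hC : 2 ^ k ≤ C u) : Solvable G C := fun v => by
  obtain ⟨p, hp⟩ := hw v
  exact exists_reach_of_walk p C ((Nat.pow_le_pow_right two_pos hp).trans hC)

lemma exists_gather (r : V) (Q : Finset V) (hQ : ∀ v ∈ Q, G.Adj v r) (C : V → ℕ) :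
    ∃ C', Relation.ReflTransGen (PebblingMove G) C C' ∧ C' r = C r + ∑ v ∈ Q, C v / 2 ∧
      ∀ w, w ≠ r → w ∉ Q → C' w = C w := by
  induction Q using Finset.induction_on with
  | empty => exact ⟨C, .refl, by simp, fun _ _ _ => rfl⟩
  | insert a Q ha ih =>
    obtain ⟨C', h1, h2, h3⟩ := ih fun v hv => hQ v (mem_insert_of_mem hv)
    have har := hQ a (mem_insert_self a Q)
    have hCa := h3 a har.ne ha
    obtain ⟨C'', h4, h5, h6⟩ := exists_transfer har (C a / 2) C' (by omega)
    refine ⟨C'', h1.trans h4, ?_, ?_⟩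
    · rw [h5, h2, sum_insert ha]; ring
    · intro w hw hwQ
      rw [mem_insert, not_or] at hwQ
      rw [h6 w hwQ.1 hw, h3 w hw hwQ.2]

lemma solvable_of_hub {r : V} {Q : Finset V} (hQ : ∀ v ∈ Q, G.Adj v r) {k : ℕ}
    (hw : ∀ v, ∃ p : G.Walk r v, p.length ≤ k) {C : V → ℕ}
    (hC : 2 ^ k ≤ ∑ v ∈ Q, C v / 2) : Solvable G C := fun v => by
  obtain ⟨C', h1, h2, -⟩ := exists_gather r Q hQ C
  obtain ⟨C'', h3, h4⟩ := solvable_of_tower hw (C := C') (by omega) v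
  exact ⟨C'', h1.trans h3, h4⟩

variable [Fintype V]

lemma PebblingMove.weight_le {w : V → ℕ} (hw : ∀ u v, G.Adj u v → w v ≤ 2 * w u) {C C' : V → ℕ}
    (h : PebblingMove G C C') : ∑ v, w v * C' v ≤ ∑ v, w v * C v := by
  obtain ⟨u, v, hadj, h2, rfl⟩ := h
  have hv : v ∈ (univ : Finset V).erase u := mem_erase.2 ⟨hadj.ne', mem_univ _⟩
  rw [← add_sum_erase _ _ (mem_univ u), ← add_sum_erase _ _ (mem_univ u),
    ← add_sum_erase _ _ hv, ← add_sum_erase _ _ hv]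
  have hrest : ∑ x ∈ (univ.erase u).erase v,
      w x * (if x = u then C u - 2 else if x = v then C v + 1 else C x) =
      ∑ x ∈ (univ.erase u).erase v, w x * C x := by
    refine sum_congr rfl fun x hx => ?_
    simp only [mem_erase, mem_univ, and_true] at hx
    simp [hx.1, hx.2]
  rw [hrest]
  simp only [if_true, hadj.ne', if_false]
  obtain ⟨c, hc⟩ := Nat.exists_eq_add_of_le h2
  have := hw u v hadj
  rw [hc, Nat.add_sub_cancel_left]
  nlinarith

lemma Solvable.le_weight {w : V → ℕ} (hw : ∀ u v, G.Adj u v → w v ≤ 2 * w u) {C : V → ℕ}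
    (h : Solvable G C) (v : V) : w v ≤ ∑ x, w x * C x := by
  obtain ⟨C', hr, hv⟩ := h v
  have hmono : ∑ x, w x * C' x ≤ ∑ x, w x * C x := by
    clear hv
    induction hr with
    | refl => rfl
    | tail _ hstep ih => exact (hstep.weight_le hw).trans ih
  calc w v ≤ w v * C' v := Nat.le_mul_of_pos_right _ hv
    _ ≤ ∑ x, w x * C' x := single_le_sum (f := fun x => w x * C' x) (fun _ _ => Nat.zero_le _)
        (mem_univ v)
    _ ≤ _ := hmono

lemma solvable_of_card_mul_le {k : ℕ} (hk : ∀ u v : V, ∃ p : G.Walk u v, p.length ≤ k)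
    [Nonempty V] {C : V → ℕ} (hC : Fintype.card V * 2 ^ k ≤ ∑ v, C v) : Solvable G C := by
  obtain ⟨u, -, hu⟩ := exists_le_of_sum_le (s := (univ : Finset V)) (f := fun _ => 2 ^ k) (g := C)
    univ_nonempty (by simpa using hC)
  exact solvable_of_tower (hk u) hu

end Dynamics

section Counting

lemma mem_configs {n t : ℕ} {C : Fin n → ℕ} : C ∈ configs n t ↔ ∑ i, C i = t := by
  simp only [configs, mem_filter, Fintype.mem_piFinset, mem_range, and_iff_right_iff_imp]
  rintro rfl i
  exact Nat.lt_succ_of_le (single_le_sum (fun _ _ => Nat.zero_le _) (mem_univ i))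

lemma card_configs (n t : ℕ) : (configs n t).card = (n + t - 1).choose t := by
  rw [← Fintype.card_coe, ← Fintype.card_congr ((Sym.equivNatSumOfFintype (Fin n) t).trans
    (Equiv.subtypeEquivRight fun C => mem_configs.symm)), Sym.card_sym_eq_choose, Fintype.card_fin]

lemma sum_configs_apply (n t : ℕ) (v : Fin n) :
    n * ∑ C ∈ configs n t, C v = t * (configs n t).card := by
  have hsymm : ∀ u, ∑ C ∈ configs n t, C u = ∑ C ∈ configs n t, C v := fun u => by
    refine sum_equiv (Equiv.arrowCongr (Equiv.swap u v) (Equiv.refl ℕ)) (fun C => ?_) fun C _ => ?_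
    · simp only [mem_configs, Equiv.arrowCongr_apply, Equiv.coe_refl, Function.comp_apply, id_eq]
      rw [Equiv.sum_comp (Equiv.swap u v).symm C]
    · simp
  calc n * ∑ C ∈ configs n t, C v = ∑ u : Fin n, ∑ C ∈ configs n t, C u := by simp [hsymm]
    _ = ∑ C ∈ configs n t, ∑ u, C u := sum_comm
    _ = ∑ _C ∈ configs n t, t := sum_congr rfl fun C hC => mem_configs.1 hC
    _ = t * (configs n t).card := by simp [mul_comm]

/-- Markov's inequality for a linear statistic of a uniformly random configuration. -/
lemma card_le_weight_mul_le (n t a : ℕ) (w : Fin n → ℕ) :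
    ((configs n t).filter fun C => a ≤ ∑ v, w v * C v).card * (a * n) ≤
      t * (∑ v, w v) * (configs n t).card := by
  calc _ = n * ∑ _C ∈ (configs n t).filter (fun C => a ≤ ∑ v, w v * C v), a := by
        rw [sum_const, smul_eq_mul]; ring
    _ ≤ n * ∑ C ∈ (configs n t).filter (fun C => a ≤ ∑ v, w v * C v), ∑ v, w v * C v := by
        gcongr with C hC
        exact (mem_filter.1 hC).2
    _ ≤ n * ∑ C ∈ configs n t, ∑ v, w v * C v := by
        gcongr
        exact filter_subset _ _
    _ = ∑ v, w v * (n * ∑ C ∈ configs n t, C v) := by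
        rw [sum_comm, mul_sum]
        refine sum_congr rfl fun v _ => ?_
        rw [← mul_sum]; ring
    _ = _ := by
        simp_rw [sum_configs_apply, ← sum_mul]; ring

lemma choose_le_choose_of_le_half {n s t : ℕ} (hst : s ≤ t) (ht : t ≤ n / 2) :
    n.choose s ≤ n.choose t := by
  induction t, hst using Nat.le_induction with
  | base => rfl
  | succ t _ ih => exact (ih (by omega)).trans (Nat.choose_le_succ_of_lt_half_left (by omega))

lemma card_few_pairs_le {n t : ℕ} (ht : t ≤ n / 2) (M : ℕ) :
    ((configs n t).filter fun C => ∑ v, C v / 2 < M).card ≤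
      M * (n.choose t * (n + M) ^ M) := by
  calc _ ≤ ((range M).biUnion fun s =>
        powersetCard (t - 2 * s) (univ : Finset (Fin n)) ×ˢ configs n s).card := by
        refine card_le_card_of_injOn (fun C => (univ.filter fun v => C v % 2 = 1, fun v => C v / 2))
          ?_ ?_
        · intro C hC
          simp only [coe_filter, Set.mem_ofPred_eq, mem_configs] at hC
          simp only [coe_biUnion, Set.mem_iUnion, mem_coe, mem_range, mem_product,
            mem_powersetCard, subset_univ, true_and, mem_configs]
          refine ⟨_, hC.2, ?_, rfl⟩
          have h1 : (univ.filter fun v => C v % 2 = 1).card = ∑ v, C v % 2 := by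
            rw [card_filter]
            refine sum_congr rfl fun v _ => ?_
            split_ifs <;> omega
          rw [h1, ← hC.1, mul_sum, eq_tsub_iff_add_eq_of_le, ← sum_add_distrib]
          · exact sum_congr rfl fun v _ => Nat.mod_add_div _ _
          · exact sum_le_sum fun v _ => Nat.mul_div_le _ _
        · intro C _ D _ h
          simp only [Prod.mk.injEq, Finset.ext_iff, mem_filter, mem_univ, true_and] at h
          funext v
          have h1 := h.1 v
          have h2 := congrFun h.2 v
          omega
    _ ≤ (range M).card * (n.choose t * (n + M) ^ M) := by
        refine card_biUnion_le_card_mul _ _ _ fun s hs => ?_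
        rw [card_product, card_powersetCard, card_univ, Fintype.card_fin, card_configs]
        rw [mem_range] at hs
        refine Nat.mul_le_mul ?_ ?_
        · exact choose_le_choose_of_le_half (Nat.sub_le _ _) ht
        · calc (n + s - 1).choose s ≤ (n + s - 1) ^ s := Nat.choose_le_pow _ _
            _ ≤ (n + M) ^ s := Nat.pow_le_pow_left (by omega) _
            _ ≤ (n + M) ^ M := Nat.pow_le_pow_right (by omega) hs.le
    _ = _ := by rw [card_range]

lemma choose_mul_exp_le (n t : ℕ) (ht : t ≤ n) :
    (n.choose t : ℝ) * Real.exp (t * (t - 1) / (2 * n)) ≤ ((n + t - 1).choose t : ℝ) := by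
  induction t with
  | zero => simp
  | succ t ih =>
    have hn : (0 : ℝ) < n := by exact_mod_cast (by omega : 0 < n)
    have htn : (t : ℝ) ≤ n := by exact_mod_cast (by omega : t ≤ n)
    have h1 : (n.choose (t + 1) : ℝ) * (t + 1) = n.choose t * (n - t) := by
      have := Nat.choose_succ_right_eq n t
      rw [← Nat.cast_sub (by omega : t ≤ n)]
      exact_mod_cast this
    have h2 : ((n + t).choose (t + 1) : ℝ) * (t + 1) = (n + t) * (n + t - 1).choose t := by
      have := Nat.add_one_mul_choose_eq (n + t - 1) t
      rw [Nat.sub_add_cancel (by omega)] at this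
      exact_mod_cast this.symm
    have h3 : (n - t : ℝ) * Real.exp (t / n) ≤ n + t := by
      have h4 : (n - t : ℝ) ≤ n * Real.exp (-(t / n)) := by
        have h5 := Real.add_one_le_exp (-(t / n : ℝ))
        have h6 : (n : ℝ) * (-(t / n) + 1) = n - t := by field_simp; ring
        rw [← h6]
        gcongr
      calc (n - t : ℝ) * Real.exp (t / n) ≤ n * Real.exp (-(t / n)) * Real.exp (t / n) := by gcongr
        _ = n := by rw [mul_assoc, ← Real.exp_add]; simp
        _ ≤ n + t := by simp
    have h7 : Real.exp (((t + 1 : ℕ) : ℝ) * ((t + 1 : ℕ) - 1) / (2 * n)) =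
        Real.exp (t * (t - 1) / (2 * n)) * Real.exp (t / n) := by
      rw [← Real.exp_add]; congr 1; push_cast; field_simp; ring
    rw [show n + (t + 1) - 1 = n + t by omega, h7]
    refine le_of_mul_le_mul_right ?_ (by positivity : (0 : ℝ) < t + 1)
    calc _ = n.choose (t + 1) * (t + 1 : ℝ) *
          (Real.exp (t * (t - 1) / (2 * n)) * Real.exp (t / n)) := by ring
      _ = (n.choose t * Real.exp (t * (t - 1) / (2 * n))) * ((n - t) * Real.exp (t / n)) := by
          rw [h1]; ring
      _ ≤ (n + t - 1).choose t * (n + t) := by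
          refine mul_le_mul (ih (by omega)) h3 ?_ (by positivity)
          exact mul_nonneg (by linarith) (Real.exp_pos _).le
      _ = _ := by rw [h2]; ring

end Counting

section Proportion

variable {n : ℕ} {G : SimpleGraph (Fin n)}

lemma card_configs_pos (hn : 0 < n) (t : ℕ) : 0 < (configs n t).card := by
  rw [card_configs]
  exact Nat.choose_pos (by omega)

open scoped Classical in
lemma half_le_solvableProportion_iff (hn : 0 < n) (t : ℕ) :
    1 / 2 ≤ solvableProportion n G t ↔
      (configs n t).card ≤ 2 * ((configs n t).filter fun C => Solvable G C).card := by
  have h := card_configs_pos hn t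
  rw [solvableProportion, ← card_configs, div_le_div_iff₀ two_pos (by exact_mod_cast h), one_mul,
    mul_comm]
  norm_cast

end Proportion

section Graphs

lemma exists_walk_of_consecutive {n : ℕ} {G : SimpleGraph (Fin n)} {a b : ℕ}
    (h : ∀ i j : Fin n, a ≤ i.val → j.val = i.val + 1 → j.val ≤ b → G.Adj i j) {i j : Fin n}
    (hi : a ≤ i.val) (hij : i.val ≤ j.val) (hj : j.val ≤ b) :
    ∃ p : G.Walk i j, p.length = j.val - i.val := by
  obtain ⟨d, hd⟩ := Nat.exists_eq_add_of_le hij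
  induction d generalizing j with
  | zero =>
    obtain rfl : j = i := Fin.ext hd
    exact ⟨.nil, by simp⟩
  | succ d ih =>
    obtain ⟨p, hp⟩ := ih (j := ⟨i + d, by omega⟩) (by simp) (by simp; omega) rfl
    refine ⟨p.concat (h _ _ (by simp; omega) (by simp; omega) hj), ?_⟩
    rw [SimpleGraph.Walk.length_concat, hp]
    simp only
    omega

lemma card_filter_val_le (n a : ℕ) : (univ.filter fun v : Fin n => v.val ≤ a).card ≤ a + 1 := by
  calc _ ≤ (range (a + 1)).card := by
        refine card_le_card_of_injOn Fin.val (fun v hv => ?_) Fin.val_injective.injOn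
        simp only [coe_filter, mem_univ, true_and, Set.mem_ofPred_eq] at hv
        simp only [coe_range, Set.mem_Iio]
        omega
    _ = a + 1 := card_range _

lemma pathClique_adj {n L : ℕ} {i j : Fin n} : (pathClique n L).Adj i j ↔ i.val ≠ j.val ∧
    ((j.val = i.val + 1 ∧ j.val ≤ L) ∨ (i.val = j.val + 1 ∧ i.val ≤ L) ∨
      (L ≤ i.val ∧ L ≤ j.val)) := by
  simp only [pathClique, SimpleGraph.fromRel_adj, ne_eq, Fin.ext_iff]
  omega

lemma pathClique_exists_walk {n L : ℕ} {i j : Fin n} (hij : i.val ≤ j.val) (hi : i.val ≤ L) :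
    ∃ p : (pathClique n L).Walk i j, p.length ≤ L - i.val + 1 ∧ (j.val ≤ L → p.length ≤ L - i.val)
    := by
  have hcons : ∀ i j : Fin n, 0 ≤ i.val → j.val = i.val + 1 → j.val ≤ L →
      (pathClique n L).Adj i j := fun i j _ h1 h2 => pathClique_adj.2 (by omega)
  rcases le_or_gt j.val L with hj | hj
  · obtain ⟨p, hp⟩ := exists_walk_of_consecutive hcons (Nat.zero_le _) hij hj
    exact ⟨p, by omega, by omega⟩
  · obtain ⟨p, hp⟩ := exists_walk_of_consecutive hcons (i := i) (j := ⟨L, by omega⟩)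
      (Nat.zero_le _) hi le_rfl
    refine ⟨p.concat (pathClique_adj.2 (by simp only; omega)), ?_, by omega⟩
    rw [SimpleGraph.Walk.length_concat, hp]

lemma pathClique_exists_walk_of_le {n L : ℕ} {i : Fin n} (hi : i.val ≤ L) (j : Fin n) :
    ∃ p : (pathClique n L).Walk i j, p.length ≤ L + 1 := by
  rcases le_total i.val j.val with h | h
  · obtain ⟨p, hp, -⟩ := pathClique_exists_walk h hi
    exact ⟨p, by omega⟩
  · obtain ⟨p, hp, -⟩ := pathClique_exists_walk h (h.trans hi)
    exact ⟨p.reverse, by rw [SimpleGraph.Walk.length_reverse]; omega⟩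

lemma pathClique_exists_walk_hub {n L : ℕ} (hL : 1 ≤ L) (hLn : L < n) (j : Fin n) :
    ∃ p : (pathClique n L).Walk ⟨L, hLn⟩ j, p.length ≤ L := by
  rcases le_total L j.val with h | h
  · obtain ⟨p, hp, -⟩ := pathClique_exists_walk (i := ⟨L, hLn⟩) h le_rfl
    exact ⟨p, by simp only at hp; omega⟩
  · obtain ⟨p, -, hp⟩ := pathClique_exists_walk (j := ⟨L, hLn⟩) h h
    exact ⟨p.reverse, by
      rw [SimpleGraph.Walk.length_reverse]
      have := hp le_rfl
      omega⟩

lemma pathClique_solvable {n L : ℕ} (hL : 1 ≤ L) (hLn : L < n) {C : Fin n → ℕ}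
    (hC : (L + 1) * 2 ^ (L + 1) + n + 2 ^ (L + 1) ≤ ∑ v, C v) : Solvable (pathClique n L) C := by
  by_cases hbig : ∃ u : Fin n, u.val ≤ L ∧ 2 ^ (L + 1) ≤ C u
  · obtain ⟨u, hu, hCu⟩ := hbig
    exact solvable_of_tower (pathClique_exists_walk_of_le hu) hCu
  push Not at hbig
  refine solvable_of_hub (r := ⟨L, hLn⟩) (Q := univ.filter fun v : Fin n => ¬ v.val ≤ L)
    (fun v hv => ?_) (pathClique_exists_walk_hub hL hLn) ?_
  · simp only [mem_filter, mem_univ, true_and] at hv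
    exact pathClique_adj.2 (by simp only; omega)
  · have hsplit := sum_filter_add_sum_filter_not univ (fun v : Fin n => v.val ≤ L) C
    have hpath : ∑ v : Fin n with v.val ≤ L, C v ≤ (L + 1) * 2 ^ (L + 1) := by
      calc _ ≤ (univ.filter fun v : Fin n => v.val ≤ L).card * 2 ^ (L + 1) :=
            sum_le_card_nsmul _ _ _ fun v hv => (hbig v (mem_filter.1 hv).2).le
        _ ≤ _ := Nat.mul_le_mul_right _ (card_filter_val_le n L)
    have hclique : ∑ v : Fin n with ¬ v.val ≤ L, C v ≤
        2 * ∑ v : Fin n with ¬ v.val ≤ L, C v / 2 + n := by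
      calc _ ≤ ∑ v : Fin n with ¬ v.val ≤ L, (2 * (C v / 2) + 1) :=
            sum_le_sum fun v _ => by omega
        _ = 2 * ∑ v : Fin n with ¬ v.val ≤ L, C v / 2 +
            (univ.filter fun v : Fin n => ¬ v.val ≤ L).card := by
            rw [sum_add_distrib, mul_sum, sum_const, smul_eq_mul, mul_one]
        _ ≤ _ := by
            gcongr
            exact (card_le_univ _).trans (by simp)
    rw [pow_succ] at *
    omega

lemma pebblingNumber_pathClique_le {n L : ℕ} (hL : 1 ≤ L) (hLn : L < n) :
    pebblingNumber (pathClique n L) ≤ (L + 1) * 2 ^ (L + 1) + n + 2 ^ (L + 1) :=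
  Nat.sInf_le fun _ hC => pathClique_solvable hL hLn hC.ge

lemma sum_two_pow_sub_le (n L : ℕ) : ∑ i ∈ range n, 2 ^ (L - i) ≤ 2 ^ (L + 1) + n := by
  induction n generalizing L with
  | zero => simp
  | succ n ih =>
    rw [sum_range_succ']
    have h := ih (L - 1)
    simp only [show ∀ i, L - 1 - i = L - (i + 1) by omega] at h
    rcases L with _ | L
    · simp at h ⊢
    · simp only [Nat.add_sub_cancel, Nat.sub_zero, pow_succ] at h ⊢
      omega

lemma le_tauAlpha_pathClique {n L : ℕ} (hL : 1 ≤ L) (hLn : 2 ^ L ≤ n) (hnL : n < 2 ^ (L + 1)) :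
    n ≤ 8 * tauAlpha n (pathClique n L) (1 / 2) := by
  classical
  have hLn' : L < n := Nat.lt_two_pow_self.trans_le hLn
  have hn : 0 < n := by omega
  have hne : {t : ℕ | 1 / 2 ≤ solvableProportion n (pathClique n L) t}.Nonempty := by
    refine ⟨(L + 1) * 2 ^ (L + 1) + n + 2 ^ (L + 1), (half_le_solvableProportion_iff hn _).2 ?_⟩
    rw [filter_true_of_mem fun C hC => pathClique_solvable hL hLn' (mem_configs.1 hC).ge]
    omega
  have hmem := Nat.sInf_mem hne
  rw [← tauAlpha] at hmem
  set t := tauAlpha n (pathClique n L) (1 / 2)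
  have h1 := (half_le_solvableProportion_iff hn _).1 hmem
  have hN := card_configs_pos hn t
  have h2 := card_le_weight_mul_le n t (2 ^ L) fun v => 2 ^ (L - v.val)
  have h3 : ((configs n t).filter fun C => Solvable (pathClique n L) C).card ≤
      ((configs n t).filter fun C => 2 ^ L ≤ ∑ v : Fin n, 2 ^ (L - v.val) * C v).card := by
    refine card_le_card (monotone_filter_right _ fun C _ hC => ?_)
    refine hC.le_weight (w := fun v => 2 ^ (L - v.val)) (fun u v huv => ?_) ⟨0, hn⟩
    rw [← pow_succ']
    rw [pathClique_adj] at huv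
    exact Nat.pow_le_pow_right two_pos (by omega)
  rw [Fin.sum_univ_eq_sum_range (fun i => 2 ^ (L - i))] at h2
  have h4 := sum_two_pow_sub_le n L
  set F := ((configs n t).filter fun C => Solvable (pathClique n L) C).card
  set N := (configs n t).card
  have h5 : N * (2 ^ L * n) ≤ N * (2 ^ L * (8 * t)) := by
    calc N * (2 ^ L * n) ≤ 2 * F * (2 ^ L * n) := by gcongr
      _ = 2 * (F * (2 ^ L * n)) := by ring
      _ ≤ 2 * (t * (2 ^ (L + 1) + 2 ^ (L + 1)) * N) := by
          refine Nat.mul_le_mul_left 2 ((Nat.mul_le_mul_right _ h3).trans (h2.trans ?_))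
          gcongr
          omega
      _ = _ := by ring
  exact Nat.le_of_mul_le_mul_left (Nat.le_of_mul_le_mul_left h5 hN) (by positivity)

lemma twoPathClique_adj {n L : ℕ} {i j : Fin n} : (twoPathClique n L).Adj i j ↔ i.val ≠ j.val ∧
    (((j.val = i.val + 1 ∧ j.val < L) ∨
      (L ≤ i.val ∧ j.val = i.val + 1 ∧ j.val < 2 * L) ∨
      (2 * L ≤ i.val ∧ 2 * L ≤ j.val) ∨
      (i.val + 1 = L ∧ j.val = 2 * L) ∨ (i.val + 1 = 2 * L ∧ j.val = 2 * L)) ∨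
      ((i.val = j.val + 1 ∧ i.val < L) ∨
      (L ≤ j.val ∧ i.val = j.val + 1 ∧ i.val < 2 * L) ∨
      (2 * L ≤ j.val ∧ 2 * L ≤ i.val) ∨
      (j.val + 1 = L ∧ i.val = 2 * L) ∨ (j.val + 1 = 2 * L ∧ i.val = 2 * L))) := by
  simp only [twoPathClique, SimpleGraph.fromRel_adj, ne_eq, Fin.ext_iff]

lemma twoPathClique_exists_walk_hub {n L : ℕ} (hL : 1 ≤ L) (hLn : 2 * L < n) (j : Fin n) :
    ∃ p : (twoPathClique n L).Walk ⟨2 * L, hLn⟩ j, p.length ≤ L := by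
  rcases lt_or_ge j.val L with h | h
  · obtain ⟨p, hp⟩ := exists_walk_of_consecutive (G := twoPathClique n L) (a := 0) (b := L - 1)
      (fun i j _ h1 h2 => twoPathClique_adj.2 (by omega)) (i := j) (j := ⟨L - 1, by omega⟩)
      (Nat.zero_le _) (by simp only; omega) le_rfl
    have hadj : (twoPathClique n L).Adj ⟨L - 1, by omega⟩ ⟨2 * L, hLn⟩ :=
      twoPathClique_adj.2 ⟨by simp only; omega,
        .inl (.inr (.inr (.inr (.inl ⟨Nat.sub_add_cancel hL, rfl⟩))))⟩
    refine ⟨(p.concat hadj).reverse, ?_⟩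
    rw [SimpleGraph.Walk.length_reverse, SimpleGraph.Walk.length_concat, hp]
    simp only
    omega
  rcases le_or_gt j.val (2 * L) with h' | h'
  · obtain ⟨p, hp⟩ := exists_walk_of_consecutive (G := twoPathClique n L) (a := L) (b := 2 * L)
      (fun i j _ h1 h2 => twoPathClique_adj.2 (by omega)) (i := j) (j := ⟨2 * L, hLn⟩)
      h h' le_rfl
    refine ⟨p.reverse, ?_⟩
    rw [SimpleGraph.Walk.length_reverse, hp]
    simp only
    omega
  · exact ⟨.cons (twoPathClique_adj.2 (by simp only; omega)) .nil, by simpa using hL⟩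

lemma le_pebblingNumber_twoPathClique {n L : ℕ} (hL : 1 ≤ L) (hLn : 2 * L < n) :
    2 ^ (2 * L) ≤ pebblingNumber (twoPathClique n L) := by
  have : Nonempty (Fin n) := ⟨⟨2 * L, hLn⟩⟩
  have hw : ∀ u v, ∃ p : (twoPathClique n L).Walk u v, p.length ≤ 2 * L := fun u v => by
    obtain ⟨p, hp⟩ := twoPathClique_exists_walk_hub hL hLn u
    obtain ⟨q, hq⟩ := twoPathClique_exists_walk_hub hL hLn v
    refine ⟨p.reverse.append q, ?_⟩
    rw [SimpleGraph.Walk.length_append, SimpleGraph.Walk.length_reverse]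
    omega
  refine le_csInf ⟨n * 2 ^ (2 * L), fun C hC => solvable_of_card_mul_le hw (by simp [hC])⟩ ?_
  intro t ht
  let w : Fin n → ℕ := fun v =>
    2 ^ (if v.val < L then v.val else if v.val < 2 * L then 3 * L - v.val else L)
  have h := (ht (Pi.single ⟨0, by omega⟩ t) (by simp)).le_weight (w := w) (fun u v huv => ?_)
    ⟨L, by omega⟩
  · have h2 : 3 * L - L = 2 * L := by omega
    have h3 : L < 2 * L := by omega
    have h4 : 0 < L := hL
    simpa [w, Pi.single_apply, h2, h3, h4] using h
  · simp only [w]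
    rw [← pow_succ']
    rw [twoPathClique_adj] at huv
    refine Nat.pow_le_pow_right two_pos ?_
    split_ifs <;> omega

lemma tauAlpha_twoPathClique_le {n L t : ℕ} (hL : 3 ≤ L) (hLn : 2 * L < n) (ht : t ≤ n / 2)
    (hfew : 4 * (2 * 2 ^ L * (n.choose t * (n + 2 * 2 ^ L) ^ (2 * 2 ^ L))) ≤
      (n + t - 1).choose t) :
    tauAlpha n (twoPathClique n L) (1 / 2) ≤ t := by
  classical
  refine Nat.sInf_le ((half_le_solvableProportion_iff (by omega) _).2 ?_)
  set w : Fin n → ℕ := fun v => if v.val ≤ 2 * L then 1 else 0 with hw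
  have hcover : (configs n t).filter (fun C => ¬ Solvable (twoPathClique n L) C) ⊆
      (configs n t).filter (fun C => ∑ v, C v / 2 < 2 * 2 ^ L) ∪
        (configs n t).filter (fun C => 2 * 2 ^ L ≤ ∑ v, w v * C v) := by
    intro C hC
    simp only [mem_union, mem_filter] at hC ⊢
    by_contra! hcon
    obtain ⟨h1, h2⟩ := And.intro (hcon.1 hC.1) (hcon.2 hC.1)
    refine hC.2 (solvable_of_hub (r := ⟨2 * L, hLn⟩)
      (Q := univ.filter fun v : Fin n => ¬ v.val ≤ 2 * L) (fun v hv => ?_)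
      (twoPathClique_exists_walk_hub (by omega) hLn) ?_)
    · simp only [mem_filter, mem_univ, true_and] at hv
      exact twoPathClique_adj.2 (by simp only; omega)
    · have hsplit := sum_filter_add_sum_filter_not univ (fun v : Fin n => v.val ≤ 2 * L)
        fun v => C v / 2
      have hpath : 2 * ∑ v : Fin n with v.val ≤ 2 * L, C v / 2 ≤ ∑ v, w v * C v := by
        simp only [hw, ite_mul, one_mul, zero_mul]
        rw [← sum_filter, mul_sum]
        exact sum_le_sum fun v _ => Nat.mul_div_le _ _
      omega
  have hfew' := card_few_pairs_le ht (2 * 2 ^ L)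
  have hmarkov := card_le_weight_mul_le n t (2 * 2 ^ L) w
  have hwsum : ∑ v, w v ≤ 2 ^ L := by
    have h1 : ∑ v, w v ≤ 2 * L + 1 := by
      simpa [hw] using card_filter_val_le n (2 * L)
    have h2 : ∀ k, 3 ≤ k → 2 * k + 1 ≤ 2 ^ k := fun k hk => by
      induction k, hk using Nat.le_induction with
      | base => norm_num
      | succ k _ ih => rw [pow_succ]; omega
    exact h1.trans (h2 L hL)
  have hcard := (card_le_card hcover).trans (card_union_le _ _)
  have htot := card_filter_add_card_filter_not (s := configs n t)
    fun C => Solvable (twoPathClique n L) C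
  rw [← card_configs] at hfew
  set N := (configs n t).card
  set B := ((configs n t).filter fun C => 2 * 2 ^ L ≤ ∑ v, w v * C v).card
  have hB : 4 * B ≤ N := by
    have h1 : 2 ^ L * n * (4 * B) ≤ 2 ^ L * n * N := by
      calc _ = 2 * (B * (2 * 2 ^ L * n)) := by ring
        _ ≤ 2 * (t * (∑ v, w v) * N) := by gcongr
        _ ≤ 2 * (n / 2 * 2 ^ L * N) := by gcongr
        _ = 2 * (n / 2) * (2 ^ L * N) := by ring
        _ ≤ n * (2 ^ L * N) := by gcongr; exact Nat.mul_div_le _ _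
        _ = _ := by ring
    exact Nat.le_of_mul_le_mul_left h1 (Nat.mul_pos (by positivity) (by omega))
  omega

end Graphs

section Asymptotics

open Filter Topology

/-- The length of the two paths of `H_n` when `m = ⌊log₂ log₂ n⌋`. -/
noncomputable def armLength (n : ℕ) : ℕ := Lp n ⌊Real.logb 2 (Real.logb 2 n)⌋₊

lemma two_rpow_half_logb_add {n : ℕ} (hn : 2 ≤ n) :
    (2 : ℝ) ^ (Real.logb 2 n / 2 + Real.logb 2 (Real.logb 2 n)) = √n * Real.logb 2 n := by
  have hn' : (1 : ℝ) < n := by exact_mod_cast hn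
  have hl : 0 < Real.logb 2 n := Real.logb_pos one_lt_two hn'
  rw [Real.rpow_add two_pos, Real.rpow_logb two_pos (by norm_num) hl, div_eq_mul_one_div,
    Real.rpow_mul two_pos.le, Real.rpow_logb two_pos (by norm_num) (by linarith),
    Real.sqrt_eq_rpow]

lemma one_le_logb_two {n : ℕ} (hn : 2 ≤ n) : 1 ≤ Real.logb 2 n := by
  rw [Real.le_logb_iff_rpow_le one_lt_two (by exact_mod_cast (by omega : 0 < n)), Real.rpow_one]
  exact_mod_cast hn

lemma two_pow_armLength_le {n : ℕ} (hn : 2 ≤ n) :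
    (2 : ℝ) ^ armLength n ≤ √n * Real.logb 2 n := by
  have hl := one_le_logb_two hn
  have hll : 0 ≤ Real.logb 2 (Real.logb 2 n) := Real.logb_nonneg one_lt_two hl
  rw [← two_rpow_half_logb_add hn, ← Real.rpow_natCast]
  refine Real.rpow_le_rpow_of_exponent_le one_le_two ?_
  have h1 := Nat.floor_le hll
  have h2 : ((armLength n : ℕ) : ℝ) ≤ _ := Nat.floor_le (by positivity)
  linarith

lemma le_two_pow_armLength {n : ℕ} (hn : 2 ≤ n) :
    √n * Real.logb 2 n / 4 ≤ (2 : ℝ) ^ armLength n := by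
  have h1 := Nat.lt_floor_add_one (Real.logb 2 (Real.logb 2 n))
  have h2 : _ < ((armLength n : ℕ) : ℝ) + 1 := Nat.lt_floor_add_one _
  rw [div_le_iff₀ (by norm_num), ← two_rpow_half_logb_add hn, ← Real.rpow_natCast,
    show (4 : ℝ) = 2 ^ (2 : ℝ) by norm_num, ← Real.rpow_add two_pos]
  exact Real.rpow_le_rpow_of_exponent_le one_le_two (by linarith)

lemma three_le_armLength {n : ℕ} (hn : 64 ≤ n) : 3 ≤ armLength n := by
  refine Nat.le_floor ?_
  have h : (6 : ℝ) ≤ Real.logb 2 n := by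
    rw [Real.le_logb_iff_rpow_le one_lt_two (by exact_mod_cast (by omega : 0 < n))]
    norm_num
    exact_mod_cast hn
  have : (0 : ℝ) ≤ (⌊Real.logb 2 (Real.logb 2 n)⌋₊ : ℝ) := Nat.cast_nonneg _
  push_cast
  linarith

lemma eventually_two_pow_armLength_mul_log_le {δ : ℝ} (hδ : 0 < δ) :
    ∀ᶠ n : ℕ in atTop, (2 : ℝ) ^ armLength n * Real.log n ≤ δ * n := by
  have hlog2 : 0 < Real.log 2 := Real.log_pos one_lt_two
  have h := ((isLittleO_log_rpow_rpow_atTop 2 (by norm_num : (0 : ℝ) < 1 / 2)).comp_tendsto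
    tendsto_natCast_atTop_atTop).bound (mul_pos hδ hlog2)
  filter_upwards [h, eventually_ge_atTop 2] with n hn hn2
  have hlog : 0 ≤ Real.log n := Real.log_natCast_nonneg n
  simp only [Function.comp_apply, Real.rpow_two, ← Real.sqrt_eq_rpow] at hn
  rw [Real.norm_of_nonneg (sq_nonneg _), Real.norm_of_nonneg (Real.sqrt_nonneg _)] at hn
  calc _ ≤ √n * Real.logb 2 n * Real.log n := by
        gcongr
        exact two_pow_armLength_le hn2
    _ = √n * Real.log n ^ 2 / Real.log 2 := by rw [Real.logb]; ring
    _ ≤ √n * (δ * Real.log 2 * √n) / Real.log 2 := by gcongr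
    _ = δ * (√n * √n) := by field_simp
    _ = δ * n := by rw [Real.mul_self_sqrt (Nat.cast_nonneg n)]

lemma eventually_two_mul_two_pow_armLength_le : ∀ᶠ n : ℕ in atTop, 2 * 2 ^ armLength n ≤ n := by
  filter_upwards [eventually_two_pow_armLength_mul_log_le (by norm_num : (0 : ℝ) < 1 / 2),
    eventually_ge_atTop 3] with n hn hn3
  have h1 : 1 ≤ Real.log n := by
    rw [Real.le_log_iff_exp_le (by exact_mod_cast (by omega : 0 < n))]
    exact Real.exp_one_lt_three.le.trans (by exact_mod_cast hn3)
  have h2 : (2 : ℝ) ^ armLength n ≤ 1 / 2 * n :=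
    (le_mul_of_one_le_right (by positivity) h1).trans hn
  have h3 : (2 : ℝ) * 2 ^ armLength n ≤ n := by linarith
  exact_mod_cast h3

lemma two_mul_armLength_lt {n : ℕ} (hn : 2 * 2 ^ armLength n ≤ n) : 2 * armLength n < n :=
  (Nat.mul_lt_mul_of_pos_left Nat.lt_two_pow_self two_pos).trans_le hn

lemma pebblingNumber_Ggraph_le {n : ℕ} (hn : 2 ≤ n) :
    (pebblingNumber (Ggraph n) : ℝ) ≤ 7 * n * Real.logb 2 n := by
  have hpow : 2 ^ Nat.log 2 n ≤ n := Nat.pow_log_le_self 2 (by omega)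
  have hL : 1 ≤ Nat.log 2 n := Nat.log_pos one_lt_two hn
  have h1 := pebblingNumber_pathClique_le hL (Nat.lt_two_pow_self.trans_le hpow)
  have h2 : pebblingNumber (Ggraph n) ≤ 2 * n * Nat.log 2 n + 5 * n := by
    refine h1.trans ?_
    rw [pow_succ]
    nlinarith [Nat.mul_le_mul_left (Nat.log 2 n) hpow]
  have h3 : (Nat.log 2 n : ℝ) ≤ Real.logb 2 n := by
    simpa using Real.natLog_le_logb n 2
  have h4 := one_le_logb_two hn
  calc (pebblingNumber (Ggraph n) : ℝ) ≤ 2 * n * Nat.log 2 n + 5 * n := by exact_mod_cast h2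
    _ ≤ 2 * n * Real.logb 2 n + 5 * n * Real.logb 2 n := by
        exact add_le_add (by gcongr) (le_mul_of_one_le_right (by positivity) h4)
    _ = _ := by ring

lemma le_pebblingNumber_Hgraph {n : ℕ} (hn : 64 ≤ n) (hn' : 2 * 2 ^ armLength n ≤ n) :
    n * Real.logb 2 n ^ 2 / 16 ≤
      (pebblingNumber (Hgraph n ⌊Real.logb 2 (Real.logb 2 n)⌋₊) : ℝ) := by
  have h1 : 2 ^ (2 * armLength n) ≤ pebblingNumber (Hgraph n ⌊Real.logb 2 (Real.logb 2 n)⌋₊) :=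
    le_pebblingNumber_twoPathClique (by have := three_le_armLength hn; omega)
      (two_mul_armLength_lt hn')
  have h2 := one_le_logb_two (by omega : 2 ≤ n)
  calc n * Real.logb 2 n ^ 2 / 16 = (√n * Real.logb 2 n / 4) ^ 2 := by
        rw [div_pow, mul_pow, Real.sq_sqrt (Nat.cast_nonneg n)]; norm_num
    _ ≤ (2 ^ armLength n) ^ 2 := by
        gcongr
        exact le_two_pow_armLength (by omega)
    _ = 2 ^ (2 * armLength n) := by rw [← pow_mul, mul_comm]
    _ ≤ _ := by exact_mod_cast h1

lemma tendsto_pebblingNumber_ratio :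
    Tendsto (fun n : ℕ => (pebblingNumber (Ggraph n) : ℝ) /
      (pebblingNumber (Hgraph n ⌊Real.logb 2 (Real.logb 2 n)⌋₊) : ℝ)) atTop (𝓝 0) := by
  have hlim : Tendsto (fun n : ℕ => 112 / Real.logb 2 n) atTop (𝓝 0) :=
    ((Real.tendsto_logb_atTop one_lt_two).comp tendsto_natCast_atTop_atTop).const_div_atTop 112
  refine squeeze_zero' (.of_forall fun n => by positivity) ?_ hlim
  filter_upwards [eventually_ge_atTop 64, eventually_two_mul_two_pow_armLength_le] with n hn hn'
  have h2 := one_le_logb_two (by omega : 2 ≤ n)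
  have hn0 : (0 : ℝ) < n := by exact_mod_cast (by omega : 0 < n)
  calc _ ≤ 7 * n * Real.logb 2 n / (n * Real.logb 2 n ^ 2 / 16) :=
        div_le_div₀ (by positivity) (pebblingNumber_Ggraph_le (by omega)) (by positivity)
          (le_pebblingNumber_Hgraph hn hn')
    _ = 112 / Real.logb 2 n := by field_simp; norm_num

lemma eventually_tauAlpha_Hgraph_le {k : ℕ} (hk : 2 ≤ k) :
    ∀ᶠ n : ℕ in atTop,
      tauAlpha n (Hgraph n ⌊Real.logb 2 (Real.logb 2 n)⌋₊) (1 / 2) ≤ n / k := by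
  have hk0 : (0 : ℝ) < k := by exact_mod_cast (by omega : 0 < k)
  filter_upwards [eventually_ge_atTop 64, eventually_ge_atTop (4 * k),
    eventually_two_mul_two_pow_armLength_le,
    eventually_two_pow_armLength_mul_log_le (by positivity : (0 : ℝ) < 1 / (64 * k ^ 2))]
    with n hn hnk hK hKlog
  have hn0 : (0 : ℝ) < n := by exact_mod_cast (by omega : 0 < n)
  refine tauAlpha_twoPathClique_le (three_le_armLength hn) (two_mul_armLength_lt hK)
    (Nat.div_le_div_left hk two_pos) ?_
  rw [← armLength]
  set K := 2 ^ armLength n with hKdef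
  set t := n / k with htdef
  have hK1 : 1 ≤ K := Nat.one_le_two_pow
  have hpairs : 4 * (2 * K) * (n + 2 * K) ^ (2 * K) ≤ (n ^ 2) ^ (4 * K) := by
    calc 4 * (2 * K) * (n + 2 * K) ^ (2 * K) ≤ (n ^ 2) * (n ^ 2) ^ (2 * K) := by
          gcongr <;> nlinarith
      _ = (n ^ 2) ^ (2 * K + 1) := (pow_succ' _ _).symm
      _ ≤ (n ^ 2) ^ (4 * K) := Nat.pow_le_pow_right (by positivity) (by omega)
  have ht : (n : ℝ) / (2 * k) + 1 ≤ t := by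
    have h1 : (n : ℝ) < k * t + k := by
      have := Nat.lt_div_mul_add (a := n) (b := k) (by omega)
      rw [mul_comm]
      exact_mod_cast this
    have h2 : (4 : ℝ) * k ≤ n := by exact_mod_cast hnk
    rw [div_add_one (by positivity), div_le_iff₀ (by positivity)]
    nlinarith
  have hexp : 8 * K * Real.log n ≤ t * (t - 1) / (2 * n) := by
    have h1 : (n : ℝ) / (2 * k) * (n / (2 * k)) ≤ t * (t - 1) := by
      have : (0 : ℝ) ≤ n / (2 * k) := by positivity
      exact mul_le_mul (by linarith) (by linarith) this (by linarith)
    calc 8 * K * Real.log n = 8 * (2 ^ armLength n * Real.log n) := by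
          rw [hKdef]; push_cast; ring
      _ ≤ 8 * (1 / (64 * k ^ 2) * n) := by gcongr
      _ = n / (2 * k) * (n / (2 * k)) / (2 * n) := by field_simp; norm_num
      _ ≤ _ := by gcongr
  have hpow : ((n : ℝ) ^ 2) ^ (4 * K) = Real.exp (8 * K * Real.log n) := by
    rw [← pow_mul, ← mul_assoc, mul_comm _ (Real.log n), Real.exp_mul, Real.exp_log hn0]
    norm_num [← Real.rpow_natCast]
  have hmain : (4 * (2 * K * (n.choose t * (n + 2 * K) ^ (2 * K))) : ℝ) ≤
      ((n + t - 1).choose t : ℝ) := by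
    calc (4 * (2 * K * (n.choose t * (n + 2 * K) ^ (2 * K))) : ℝ)
        = n.choose t * (4 * (2 * K) * (n + 2 * K) ^ (2 * K)) := by ring
      _ ≤ n.choose t * (n ^ 2) ^ (4 * K) := by gcongr; exact_mod_cast hpairs
      _ ≤ n.choose t * Real.exp (t * (t - 1) / (2 * n)) := by rw [hpow]; gcongr
      _ ≤ _ := choose_mul_exp_le n t (Nat.div_le_self _ _)
  exact_mod_cast hmain

end Asymptotics

/-- With `m = m(n) = ⌊log₂ log₂ n⌋`: (i) `π(G_n)/π(H_n) → 0`; and (ii)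
still `τ_{1/2}(G_n) ∉ O(τ_{1/2}(H_n))`: for every `c > 0`, eventually
`τ_{1/2}(G_n) > c·τ_{1/2}(H_n)`. Hence the conjecture fails even assuming
`limsup π(G_n)/π(H_n) < 1`. -/
theorem counterexample_with_vanishing_ratio :
    Filter.Tendsto (fun n : ℕ =>
        (pebblingNumber (Ggraph n) : ℝ) /
          (pebblingNumber (Hgraph n ⌊Real.logb 2 (Real.logb 2 n)⌋₊) : ℝ))
        Filter.atTop (nhds 0) ∧
      ∀ c : ℝ, 0 < c →
        ∀ᶠ n : ℕ in Filter.atTop,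
          c * (tauAlpha n (Hgraph n ⌊Real.logb 2 (Real.logb 2 n)⌋₊) (1 / 2) : ℝ) <
            (tauAlpha n (Ggraph n) (1 / 2) : ℝ) := by

  refine ⟨tendsto_pebblingNumber_ratio, fun c hc => ?_⟩
  obtain ⟨k, hk⟩ := exists_nat_gt (8 * c)
  filter_upwards [eventually_tauAlpha_Hgraph_le (le_max_left 2 k), Filter.eventually_ge_atTop 2]
    with n hH hn
  have hn0 : (0 : ℝ) < n := by exact_mod_cast (by omega : 0 < n)
  have hG : n ≤ 8 * tauAlpha n (Ggraph n) (1 / 2) :=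
    le_tauAlpha_pathClique (Nat.log_pos one_lt_two hn) (Nat.pow_log_le_self 2 (by omega))
      (Nat.lt_pow_succ_log_self one_lt_two n)
  have hG' : (n : ℝ) ≤ 8 * tauAlpha n (Ggraph n) (1 / 2) := by exact_mod_cast hG
  have hk' : 8 * c < (max 2 k : ℕ) := hk.trans_le (by exact_mod_cast le_max_right 2 k)
  have hH' : (tauAlpha n (Hgraph n ⌊Real.logb 2 (Real.logb 2 n)⌋₊) (1 / 2) : ℝ) ≤
      n / (max 2 k : ℕ) := (Nat.cast_le.2 hH).trans Nat.cast_div_le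
  calc _ ≤ c * (n / (max 2 k : ℕ)) := by gcongr
    _ < n / 8 := by
        rw [mul_div_assoc', div_lt_div_iff₀ (by linarith) (by norm_num)]
        nlinarith
    _ ≤ _ := by linarith
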